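/- arXiv:2308.05471 — 2 statements merged into one kernel-verified Lean document; each statement's English description precedes it below -/
import Mathlib

section
/- (Value-gap decomposition.) Let S and A be finite sets and H ∈ ℕ the horizon. Let P⋆ = {P⋆_h} and P̂ = {P̂_h} be transition kernel sequences S × A → Δ(S), let r = {r_h} be rewards r_h : S × A → ℝ, let π⋆ and π be policies, and fix an initial state s₁ ∈ S. Then V^{π⋆}_{1,P⋆,r}(s₁) − V^{π}_{1,P̂,r}(s₁) = Σ_{h=1}^{H} E_{(s_h,a_h) ∼ (P⋆,π⋆)} [ Σ_{s′∈S} ( P⋆_h(s′|s_h,a_h) − P̂_h(s′|s_h,a_h) ) · V^π_{h+1,P̂,r}(s′) ] + Σ_{h=1}^{H} E_{s_h ∼ (P⋆,π⋆)} [ Σ_{a∈A} Q^π_{h,P̂,r}(s_h,a) · ( π⋆_h(a|s_h) − π_h(a|s_h) ) ]. -/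
/-- Pushing a state distribution `d` one step forward through a policy `p` and a kernel `P`, then
integrating `f`, equals integrating the one-step expectation of `f` against `d`. -/
theorem sum_pushforward_mul {S A : Type*} [Fintype S] [Fintype A]
    (d : S → ℝ) (p : S → A → ℝ) (P : S → A → S → ℝ) (f : S → ℝ) :
    ∑ s', (∑ s, ∑ a, d s * p s a * P s a s') * f s' =
      ∑ s, d s * ∑ a, p s a * ∑ s', P s a s' * f s' := by
  simp only [Finset.sum_mul, Finset.mul_sum]
  rw [Finset.sum_comm]
  refine Finset.sum_congr rfl fun s _ => ?_
  rw [Finset.sum_comm]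
  refine Finset.sum_congr rfl fun a _ => Finset.sum_congr rfl fun s' _ => ?_
  ring

/-- Value-gap decomposition. -/
theorem stmt_6 {S A : Type*} [Fintype S] [Fintype A] [DecidableEq S]
    (H : ℕ)
    (Pstar Phat : ℕ → S → A → S → ℝ)
    (hPstar : ∀ h ∈ Finset.Icc 1 H, ∀ s a, (∀ s', 0 ≤ Pstar h s a s') ∧ ∑ s', Pstar h s a s' = 1)
    (hPhat : ∀ h ∈ Finset.Icc 1 H, ∀ s a, (∀ s', 0 ≤ Phat h s a s') ∧ ∑ s', Phat h s a s' = 1)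
    (r : ℕ → S → A → ℝ)
    (πstar π : ℕ → S → A → ℝ)
    (hπstar : ∀ h ∈ Finset.Icc 1 H, ∀ s, (∀ a, 0 ≤ πstar h s a) ∧ ∑ a, πstar h s a = 1)
    (hπ : ∀ h ∈ Finset.Icc 1 H, ∀ s, (∀ a, 0 ≤ π h s a) ∧ ∑ a, π h s a = 1)
    (s₁ : S)
    -- value functions of `πstar` under `(Pstar, r)`
    (Vstar : ℕ → S → ℝ)
    (hVstartop : ∀ s, Vstar (H + 1) s = 0)
    (hVstar : ∀ h ∈ Finset.Icc 1 H, ∀ s,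
      Vstar h s = ∑ a, πstar h s a * (r h s a + ∑ s', Pstar h s a s' * Vstar (h + 1) s'))
    -- value functions of `π` under `(Phat, r)`
    (Vhat : ℕ → S → ℝ) (Qhat : ℕ → S → A → ℝ)
    (hVhattop : ∀ s, Vhat (H + 1) s = 0)
    (hQhat : ∀ h ∈ Finset.Icc 1 H, ∀ s a,
      Qhat h s a = r h s a + ∑ s', Phat h s a s' * Vhat (h + 1) s')
    (hVhat : ∀ h ∈ Finset.Icc 1 H, ∀ s, Vhat h s = ∑ a, π h s a * Qhat h s a)
    -- step-`h` state distribution under `(Pstar, πstar)` started from `s₁`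
    (dstar : ℕ → S → ℝ)
    (hdstar1 : ∀ s, dstar 1 s = if s = s₁ then 1 else 0)
    (hdstar : ∀ h ∈ Finset.Icc 1 H, ∀ s',
      dstar (h + 1) s' = ∑ s, ∑ a, dstar h s * πstar h s a * Pstar h s a s') :
    Vstar 1 s₁ - Vhat 1 s₁ =
      (∑ h ∈ Finset.Icc 1 H, ∑ s, dstar h s *
        ∑ a, πstar h s a * ∑ s', (Pstar h s a s' - Phat h s a s') * Vhat (h + 1) s') +
      ∑ h ∈ Finset.Icc 1 H, ∑ s, dstar h s *
        ∑ a, Qhat h s a * (πstar h s a - π h s a) := by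
  set gap : ℕ → ℝ := fun h => ∑ s, dstar h s * (Vstar h s - Vhat h s) with hgap
  have gap_one : gap 1 = Vstar 1 s₁ - Vhat 1 s₁ := by simp [hgap, hdstar1]
  have gap_top : gap (H + 1) = 0 := by simp [hgap, hVstartop, hVhattop]
  have gap_step : ∀ h ∈ Finset.Icc 1 H,
      (∑ s, dstar h s *
        ∑ a, πstar h s a * ∑ s', (Pstar h s a s' - Phat h s a s') * Vhat (h + 1) s') +
      ∑ s, dstar h s * ∑ a, Qhat h s a * (πstar h s a - π h s a) = gap h - gap (h + 1) := by
    intro h hh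
    have push : gap (h + 1) = ∑ s, dstar h s * ∑ a, πstar h s a *
        ∑ s', Pstar h s a s' * (Vstar (h + 1) s' - Vhat (h + 1) s') := by
      simp only [hgap, hdstar h hh, sum_pushforward_mul]
    rw [push, hgap, ← Finset.sum_add_distrib, ← Finset.sum_sub_distrib]
    refine Finset.sum_congr rfl fun s _ => ?_
    rw [← mul_add, ← mul_sub, hVstar h hh, hVhat h hh, ← Finset.sum_add_distrib,
      ← Finset.sum_sub_distrib, ← Finset.sum_sub_distrib]
    congr 1
    refine Finset.sum_congr rfl fun a _ => ?_
    simp only [hQhat h hh, sub_mul, mul_sub, Finset.sum_sub_distrib]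
    ring
  have telescope : ∑ h ∈ Finset.Icc 1 H, (gap (h + 1) - gap h) = gap (H + 1) - gap 1 := by
    rw [← Finset.Ico_add_one_right_eq_Icc]
    exact Finset.sum_Ico_sub gap (by omega)
  rw [← Finset.sum_add_distrib, Finset.sum_congr rfl gap_step, ← gap_one]
  rw [Finset.sum_sub_distrib] at telescope ⊢
  linarith
end

section
/- (Performance-difference term bound.) Let S and A be finite sets, H, K, L, τ ∈ ℕ with H ≥ 1 and K = L·τ, fix an initial state s₁ ∈ S, and set η = √(L·log|A| / K). For each k ∈ {1,…,K} let P^{⋆,k} = {P^{⋆,k}_h} be a transition kernel sequence, π^{⋆,k} a comparator policy, Q̂^k_h : S × A → [0,1], and let the policies π^k be generated by: π^k_h(·|s) uniform on A whenever k ≡ 1 (mod τ), and otherwise π^{k}_h(a|s) ∝ π^{k−1}_h(a|s)·exp(η·Q̂^{k−1}_h(s,a)). Let d^k_h ∈ Δ(S) be the step-h state distribution under (P^{⋆,k}, π^{⋆,k}) started from s₁. Then Σ_{k=1}^{K} Σ_{h=1}^{H} E_{s∼d^k_h} [ Σ_{a∈A} Q̂^k_h(s,a)·( π^{⋆,k}_h(a|s)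 − π^k_h(a|s) ) ] ≤ 2·H·K·√(log|A| / τ) + 3·H·τ·( Δ^P + Δ^π ), where Δ^P = Σ_{k=2}^{K} Σ_{h=1}^{H} max_{(s,a)} ‖P^{⋆,k}_h(·|s,a) − P^{⋆,k−1}_h(·|s,a)‖_TV and Δ^π = Σ_{k=2}^{K} Σ_{h=1}^{H} max_{s} ‖π^{⋆,k}_h(·|s) − π^{⋆,k−1}_h(·|s)‖_TV. -/
open Finset in
/-- Second-order bound on the log-partition function of a `[0, 1]`-valued payoff. -/
theorem sum_mul_exp_le_exp {A : Type*} [Fintype A] {p q : A → ℝ} {η : ℝ} (hη : 0 ≤ η)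
    (hp : ∀ a, 0 ≤ p a) (hp1 : ∑ a, p a = 1) (hq : ∀ a, 0 ≤ q a ∧ q a ≤ 1) :
    ∑ a, p a * Real.exp (η * q a) ≤ Real.exp (η * ∑ a, p a * q a + η ^ 2) := by
  have hpq : 0 ≤ ∑ a, p a * q a := sum_nonneg fun a _ => mul_nonneg (hp a) (hq a).1
  rcases le_total η 1 with h1 | h1
  · have hexp : ∀ a, Real.exp (η * q a) ≤ 1 + η * q a + η ^ 2 := fun a => by
      have h0 : 0 ≤ η * q a := mul_nonneg hη (hq a).1
      have hle : η * q a ≤ η := mul_le_of_le_one_right hη (hq a).2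
      have := (abs_le.1 (Real.abs_exp_sub_one_sub_id_le
        (abs_le.2 ⟨by linarith, hle.trans h1⟩))).2
      nlinarith
    calc ∑ a, p a * Real.exp (η * q a) ≤ ∑ a, p a * (1 + η * q a + η ^ 2) :=
          sum_le_sum fun a _ => mul_le_mul_of_nonneg_left (hexp a) (hp a)
      _ = ∑ a, (p a + η * (p a * q a) + η ^ 2 * p a) := sum_congr rfl fun a _ => by ring
      _ = (η * ∑ a, p a * q a + η ^ 2) + 1 := by
          rw [sum_add_distrib, sum_add_distrib, ← mul_sum, ← mul_sum, hp1]; ring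
      _ ≤ _ := Real.add_one_le_exp _
  · calc ∑ a, p a * Real.exp (η * q a)
        ≤ ∑ a, p a * Real.exp (η * ∑ a, p a * q a + η ^ 2) := by
          refine sum_le_sum fun a _ => mul_le_mul_of_nonneg_left (Real.exp_le_exp.2 ?_) (hp a)
          nlinarith [mul_le_of_le_one_right hη (hq a).2, mul_nonneg hη hpq]
      _ = _ := by rw [← sum_mul, hp1, one_mul]

/-- Exponential-weights iterates stay in the interior of the simplex. -/
theorem expWeights_simplex {A : Type*} [Fintype A] [Nonempty A] {p q : ℕ → A → ℝ} {η : ℝ} {n : ℕ}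
    (h0 : ∀ a, p 0 a = 1 / (Fintype.card A : ℝ))
    (hs : ∀ i, i + 1 < n → ∀ a, p (i + 1) a = p i a * Real.exp (η * q i a) /
      ∑ b, p i b * Real.exp (η * q i b)) :
    ∀ i, i < n → (∀ a, 0 < p i a) ∧ ∑ a, p i a = 1 := by
  have hA : (0 : ℝ) < Fintype.card A := by exact_mod_cast Fintype.card_pos
  intro i
  induction i with
  | zero =>
    intro _
    refine ⟨fun a => by rw [h0]; positivity, ?_⟩
    simp only [h0, Finset.sum_const, Finset.card_univ, nsmul_eq_mul]
    field_simp
  | succ i ih =>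
    intro hi
    obtain ⟨hp, -⟩ := ih (by omega)
    have hZ : 0 < ∑ b, p i b * Real.exp (η * q i b) :=
      Finset.sum_pos (fun b _ => mul_pos (hp b) (Real.exp_pos _)) Finset.univ_nonempty
    refine ⟨fun a => by rw [hs i hi]; exact div_pos (mul_pos (hp a) (Real.exp_pos _)) hZ, ?_⟩
    simp only [hs i hi]
    rw [← Finset.sum_div, div_self (ne_of_gt hZ)]

/-- Regret of exponential weights against a fixed action. -/
theorem expWeights_regret_action {A : Type*} [Fintype A] [Nonempty A] {p q : ℕ → A → ℝ} {η : ℝ}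
    {n : ℕ} (hη : 0 ≤ η) (hq : ∀ i < n, ∀ a, 0 ≤ q i a ∧ q i a ≤ 1)
    (h0 : ∀ a, p 0 a = 1 / (Fintype.card A : ℝ))
    (hs : ∀ i, i + 1 < n → ∀ a, p (i + 1) a = p i a * Real.exp (η * q i a) /
      ∑ b, p i b * Real.exp (η * q i b)) (a : A) :
    η * ∑ i ∈ Finset.range n, q i a ≤ Real.log (Fintype.card A) +
      η * ∑ i ∈ Finset.range n, ∑ b, p i b * q i b + n * η ^ 2 := by
  have hA : (0 : ℝ) < Fintype.card A := by exact_mod_cast Fintype.card_pos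
  have hlogA : 0 ≤ Real.log (Fintype.card A) := Real.log_natCast_nonneg _
  have hsim := expWeights_simplex h0 hs
  have hZ : ∀ i < n, Real.log (∑ b, p i b * Real.exp (η * q i b)) ≤
      η * ∑ b, p i b * q i b + η ^ 2 := fun i hi => by
    rw [Real.log_le_iff_le_exp (Finset.sum_pos
      (fun b _ => mul_pos ((hsim i hi).1 b) (Real.exp_pos _)) Finset.univ_nonempty)]
    exact sum_mul_exp_le_exp hη (fun b => ((hsim i hi).1 b).le) (hsim i hi).2 (hq i hi)
  have key : ∀ i, i < n → η * ∑ j ∈ Finset.range i, q j a ≤ Real.log (Fintype.card A) +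
      η * ∑ j ∈ Finset.range i, ∑ b, p j b * q j b + i * η ^ 2 + Real.log (p i a) := by
    intro i
    induction i with
    | zero => intro _; simp [h0]
    | succ i ih =>
      intro hi
      have hi' : i < n := by omega
      have hpos := Finset.sum_pos (fun b (_ : b ∈ Finset.univ) =>
        mul_pos ((hsim i hi').1 b) (Real.exp_pos (η * q i b))) Finset.univ_nonempty
      have := ih hi'
      have := hZ i hi'
      rw [hs i hi, Real.log_div (mul_pos ((hsim i hi').1 a) (Real.exp_pos _)).ne' hpos.ne',
        Real.log_mul ((hsim i hi').1 a).ne' (Real.exp_pos _).ne', Real.log_exp,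
        Finset.sum_range_succ, Finset.sum_range_succ]
      push_cast
      linarith
  rcases n with _ | n
  · simpa using hlogA
  · have hn : n < n + 1 := by omega
    have h1 := key n hn
    have h2 := hZ n hn
    have hle : p n a * Real.exp (η * q n a) ≤ ∑ b, p n b * Real.exp (η * q n b) :=
      Finset.single_le_sum (f := fun b => p n b * Real.exp (η * q n b))
        (fun b _ => (mul_pos ((hsim n hn).1 b) (Real.exp_pos _)).le) (Finset.mem_univ a)
    have h3 := Real.log_le_log (mul_pos ((hsim n hn).1 a) (Real.exp_pos _)) hle
    rw [Real.log_mul ((hsim n hn).1 a).ne' (Real.exp_pos _).ne', Real.log_exp] at h3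
    rw [Finset.sum_range_succ, Finset.sum_range_succ]
    push_cast
    linarith

/-- Regret of exponential weights with the tuned step size against a fixed mixed action. -/
theorem expWeights_regret {A : Type*} [Fintype A] [Nonempty A] {p q : ℕ → A → ℝ} {η : ℝ}
    {n : ℕ} (hn : 0 < n) (hη : η = Real.sqrt (Real.log (Fintype.card A) / n))
    (hq : ∀ i < n, ∀ a, 0 ≤ q i a ∧ q i a ≤ 1)
    (h0 : ∀ a, p 0 a = 1 / (Fintype.card A : ℝ))
    (hs : ∀ i, i + 1 < n → ∀ a, p (i + 1) a = p i a * Real.exp (η * q i a) /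
      ∑ b, p i b * Real.exp (η * q i b))
    {c : A → ℝ} (hc : ∀ a, 0 ≤ c a) (hc1 : ∑ a, c a = 1) :
    ∑ i ∈ Finset.range n, ∑ a, q i a * (c a - p i a) ≤ 2 * n * η := by
  have hn' : (0 : ℝ) < n := by exact_mod_cast hn
  have hη0 : 0 ≤ η := hη ▸ Real.sqrt_nonneg _
  have hlogA : 0 ≤ Real.log (Fintype.card A) := Real.log_natCast_nonneg _
  have hlog : Real.log (Fintype.card A) = n * η ^ 2 := by
    rw [hη, Real.sq_sqrt (by positivity)]; field_simp
  rcases hη0.eq_or_lt with hz | hpos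
  · have hcard : Fintype.card A = 1 := by
      rw [← hz] at hlog
      have hA : (1 : ℝ) ≤ Fintype.card A := by exact_mod_cast Fintype.card_pos
      have := Real.eq_one_of_pos_of_log_eq_zero (by linarith : (0 : ℝ) < Fintype.card A)
        (by simpa using hlog)
      exact_mod_cast this
    obtain ⟨a₀, ha₀⟩ := Fintype.card_eq_one_iff.1 hcard
    have : Unique A := ⟨⟨a₀⟩, ha₀⟩
    refine (Finset.sum_nonpos fun i hi => ?_).trans (by positivity)
    have h1 := (expWeights_simplex h0 hs i (Finset.mem_range.1 hi)).2
    rw [Fintype.sum_unique] at h1 hc1 ⊢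
    simp [h1, hc1]
  · have hact := expWeights_regret_action hη0 hq h0 hs
    have hsum : ∑ a, c a * (η * ∑ i ∈ Finset.range n, q i a) ≤
        ∑ a, c a * (Real.log (Fintype.card A) +
          η * ∑ i ∈ Finset.range n, ∑ b, p i b * q i b + n * η ^ 2) :=
      Finset.sum_le_sum fun a _ => mul_le_mul_of_nonneg_left (hact a) (hc a)
    rw [← Finset.sum_mul, hc1, one_mul, hlog] at hsum
    have hL : ∑ a, c a * (η * ∑ i ∈ Finset.range n, q i a) =
        η * ∑ i ∈ Finset.range n, ∑ a, c a * q i a := by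
      simp only [Finset.mul_sum]
      rw [Finset.sum_comm]
      exact Finset.sum_congr rfl fun i _ => Finset.sum_congr rfl fun a _ => by ring
    have hR : ∑ i ∈ Finset.range n, ∑ a, q i a * (c a - p i a) =
        ∑ i ∈ Finset.range n, ∑ a, c a * q i a - ∑ i ∈ Finset.range n, ∑ b, p i b * q i b := by
      rw [← Finset.sum_sub_distrib]
      refine Finset.sum_congr rfl fun i _ => ?_
      rw [← Finset.sum_sub_distrib]
      exact Finset.sum_congr rfl fun a _ => by ring
    rw [hL] at hsum
    rw [hR]
    refine le_of_mul_le_mul_left ?_ hpos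
    linarith

/-- The `ℓ¹` distance between the ends of a path is at most its length. -/
theorem sum_abs_sub_le_path {α : Type*} [Fintype α] (x : ℕ → α → ℝ) (m i : ℕ) :
    ∑ a, |x (m + i) a - x m a| ≤
      ∑ j ∈ Finset.range i, ∑ a, |x (m + j + 1) a - x (m + j) a| := by
  induction i with
  | zero => simp
  | succ i ih =>
    rw [Finset.sum_range_succ]
    refine le_trans ?_ (add_le_add_left ih _)
    rw [← Finset.sum_add_distrib]
    refine Finset.sum_le_sum fun a _ => ?_
    have := abs_sub_le (x (m + (i + 1)) a) (x (m + i) a) (x m a)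
    rw [← add_assoc] at this ⊢
    linarith

open Finset in
/-- One-step `ℓ¹` perturbation bound for the state distribution of a controlled Markov chain. -/
theorem sum_abs_step_sub_le {S A : Type*} [Fintype S] [Fintype A] {d d' : S → ℝ}
    {p p' : S → A → ℝ} {T T' : S → A → S → ℝ} {u v : ℝ}
    (hd : ∀ s, 0 ≤ d' s) (hd1 : ∑ s, d' s = 1)
    (hp : ∀ s, (∀ a, 0 ≤ p s a) ∧ ∑ a, p s a = 1)
    (hp' : ∀ s, (∀ a, 0 ≤ p' s a) ∧ ∑ a, p' s a = 1)
    (hT : ∀ s a, (∀ s', 0 ≤ T s a s') ∧ ∑ s', T s a s' = 1)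
    (hu : ∀ s, ∑ a, |p s a - p' s a| ≤ u) (hv : ∀ s a, ∑ s', |T s a s' - T' s a s'| ≤ v) :
    ∑ s', |∑ s, ∑ a, d s * p s a * T s a s' - ∑ s, ∑ a, d' s * p' s a * T' s a s'| ≤
      ∑ s, |d s - d' s| + u + v := by
  have hpt : ∀ s', |∑ s, ∑ a, d s * p s a * T s a s' - ∑ s, ∑ a, d' s * p' s a * T' s a s'| ≤
      ∑ s, ∑ a, (|d s - d' s| * p s a * T s a s' + d' s * |p s a - p' s a| * T s a s' +
        d' s * p' s a * |T s a s' - T' s a s'|) := fun s' => by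
    rw [← sum_sub_distrib]
    refine (abs_sum_le_sum_abs _ _).trans (sum_le_sum fun s _ => ?_)
    rw [← sum_sub_distrib]
    refine (abs_sum_le_sum_abs _ _).trans (sum_le_sum fun a _ => ?_)
    have e : d s * p s a * T s a s' - d' s * p' s a * T' s a s' =
        (d s - d' s) * p s a * T s a s' + d' s * (p s a - p' s a) * T s a s' +
          d' s * p' s a * (T s a s' - T' s a s') := by ring
    rw [e]
    refine (abs_add_three _ _ _).trans (le_of_eq ?_)
    simp only [abs_mul, abs_of_nonneg (hd s), abs_of_nonneg ((hp s).1 a),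
      abs_of_nonneg ((hp' s).1 a), abs_of_nonneg ((hT s a).1 s')]
  refine (sum_le_sum fun s' _ => hpt s').trans ?_
  have hsa : ∀ s, ∑ a, ∑ s', (|d s - d' s| * p s a * T s a s' +
      d' s * |p s a - p' s a| * T s a s' + d' s * p' s a * |T s a s' - T' s a s'|) ≤
      |d s - d' s| + d' s * u + d' s * v := fun s => by
    simp only [sum_add_distrib, ← mul_sum, (hT _ _).2, mul_one, (hp s).2]
    refine add_le_add (add_le_add le_rfl (mul_le_mul_of_nonneg_left (hu s) (hd s))) ?_
    calc ∑ a, d' s * p' s a * ∑ s', |T s a s' - T' s a s'| ≤ ∑ a, d' s * p' s a * v :=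
          sum_le_sum fun a _ => mul_le_mul_of_nonneg_left (hv s a)
            (mul_nonneg (hd s) ((hp' s).1 a))
      _ = d' s * v := by rw [← sum_mul, ← mul_sum, (hp' s).2, mul_one]
  rw [sum_comm]
  refine (sum_le_sum fun s _ => sum_comm.trans_le (hsa s)).trans (le_of_eq ?_)
  rw [sum_add_distrib, sum_add_distrib, ← sum_mul, ← sum_mul, hd1, one_mul, one_mul]

/-- The state distributions of a finite-horizon controlled Markov chain are distributions. -/
theorem stateDist_simplex {S A : Type*} [Fintype S] [Fintype A] [DecidableEq S] {H : ℕ} {s₁ : S}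
    {d : ℕ → S → ℝ} {p : ℕ → S → A → ℝ} {T : ℕ → S → A → S → ℝ}
    (hp : ∀ h ∈ Finset.Icc 1 H, ∀ s, (∀ a, 0 ≤ p h s a) ∧ ∑ a, p h s a = 1)
    (hT : ∀ h ∈ Finset.Icc 1 H, ∀ s a, (∀ s', 0 ≤ T h s a s') ∧ ∑ s', T h s a s' = 1)
    (hd1 : ∀ s, d 1 s = if s = s₁ then 1 else 0)
    (hd : ∀ h ∈ Finset.Icc 1 H, ∀ s', d (h + 1) s' = ∑ s, ∑ a, d h s * p h s a * T h s a s')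
    {h : ℕ} (h1 : 1 ≤ h) : h ≤ H → (∀ s, 0 ≤ d h s) ∧ ∑ s, d h s = 1 := by
  induction h, h1 using Nat.le_induction with
  | base =>
    intro _
    refine ⟨fun s => by rw [hd1]; split_ifs <;> norm_num, by simp [hd1]⟩
  | succ h h1 ih =>
    intro hle
    have hm : h ∈ Finset.Icc 1 H := Finset.mem_Icc.2 ⟨h1, by omega⟩
    obtain ⟨i0, i1⟩ := ih (by omega)
    refine ⟨fun s' => ?_, ?_⟩
    · rw [hd h hm]
      exact Finset.sum_nonneg fun s _ => Finset.sum_nonneg fun a _ =>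
        mul_nonneg (mul_nonneg (i0 s) ((hp h hm s).1 a)) ((hT h hm s a).1 s')
    · simp only [hd h hm]
      rw [Finset.sum_comm]
      rw [← i1]
      refine Finset.sum_congr rfl fun s _ => ?_
      rw [Finset.sum_comm]
      simp only [← Finset.mul_sum, (hT h hm s _).2, mul_one, (hp h hm s).2]

/-- `ℓ¹` perturbation bound for the state distributions of two controlled Markov chains. -/
theorem sum_abs_stateDist_sub_le {S A : Type*} [Fintype S] [Fintype A] [DecidableEq S] {H : ℕ}
    {s₁ : S} {d d' : ℕ → S → ℝ} {p p' : ℕ → S → A → ℝ} {T T' : ℕ → S → A → S → ℝ} {u v : ℕ → ℝ}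
    (hp : ∀ h ∈ Finset.Icc 1 H, ∀ s, (∀ a, 0 ≤ p h s a) ∧ ∑ a, p h s a = 1)
    (hp' : ∀ h ∈ Finset.Icc 1 H, ∀ s, (∀ a, 0 ≤ p' h s a) ∧ ∑ a, p' h s a = 1)
    (hT : ∀ h ∈ Finset.Icc 1 H, ∀ s a, (∀ s', 0 ≤ T h s a s') ∧ ∑ s', T h s a s' = 1)
    (hT' : ∀ h ∈ Finset.Icc 1 H, ∀ s a, (∀ s', 0 ≤ T' h s a s') ∧ ∑ s', T' h s a s' = 1)
    (hd1 : ∀ s, d 1 s = if s = s₁ then 1 else 0) (hd1' : ∀ s, d' 1 s = if s = s₁ then 1 else 0)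
    (hd : ∀ h ∈ Finset.Icc 1 H, ∀ s', d (h + 1) s' = ∑ s, ∑ a, d h s * p h s a * T h s a s')
    (hd' : ∀ h ∈ Finset.Icc 1 H, ∀ s', d' (h + 1) s' = ∑ s, ∑ a, d' h s * p' h s a * T' h s a s')
    (hu : ∀ h ∈ Finset.Icc 1 H, ∀ s, ∑ a, |p h s a - p' h s a| ≤ u h)
    (hv : ∀ h ∈ Finset.Icc 1 H, ∀ s a, ∑ s', |T h s a s' - T' h s a s'| ≤ v h)
    {h : ℕ} (h1 : 1 ≤ h) : h ≤ H →
    ∑ s, |d h s - d' h s| ≤ ∑ i ∈ Finset.Ico 1 h, (u i + v i) := by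
  induction h, h1 using Nat.le_induction with
  | base => intro _; simp [hd1, hd1']
  | succ h h1 ih =>
    intro hle
    have hm : h ∈ Finset.Icc 1 H := Finset.mem_Icc.2 ⟨h1, by omega⟩
    obtain ⟨i0, i1⟩ := stateDist_simplex hp' hT' hd1' hd' h1 (by omega)
    have := sum_abs_step_sub_le (d := d h) i0 i1 (hp h hm) (hp' h hm) (hT h hm) (hu h hm) (hv h hm)
    have := ih (by omega)
    simp only [hd h hm, hd' h hm]
    rw [Finset.sum_Ico_succ_top h1]
    linarith

open Finset in
/-- Cost of replacing a state distribution and a comparator policy by nearby ones. -/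
theorem sum_mul_advantage_le {S A : Type*} [Fintype S] [Fintype A] {d d' : S → ℝ}
    {p p' r q : S → A → ℝ} {u : ℝ} (hd : ∀ s, 0 ≤ d' s) (hd1 : ∑ s, d' s = 1)
    (hp : ∀ s, (∀ a, 0 ≤ p s a) ∧ ∑ a, p s a = 1)
    (hr : ∀ s, (∀ a, 0 ≤ r s a) ∧ ∑ a, r s a = 1)
    (hq : ∀ s a, 0 ≤ q s a ∧ q s a ≤ 1) (hu : ∀ s, ∑ a, |p s a - p' s a| ≤ u) :
    ∑ s, d s * ∑ a, q s a * (p s a - r s a) ≤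
      ∑ s, d' s * ∑ a, q s a * (p' s a - r s a) + ∑ s, |d s - d' s| + u := by
  have havg : ∀ w : S → A → ℝ, (∀ s, (∀ a, 0 ≤ w s a) ∧ ∑ a, w s a = 1) →
      ∀ s, 0 ≤ ∑ a, q s a * w s a ∧ ∑ a, q s a * w s a ≤ 1 := fun w hw s =>
    ⟨sum_nonneg fun a _ => mul_nonneg (hq s a).1 ((hw s).1 a),
      (sum_le_sum fun a _ => mul_le_of_le_one_left ((hw s).1 a) (hq s a).2).trans (hw s).2.le⟩
  have hg : ∀ s, |∑ a, q s a * (p s a - r s a)| ≤ 1 := fun s => by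
    simp only [mul_sub, sum_sub_distrib]
    have h1 := havg p hp s
    have h2 := havg r hr s
    exact abs_le.2 ⟨by linarith, by linarith⟩
  have hpu : ∀ s, ∑ a, q s a * (p s a - r s a) - ∑ a, q s a * (p' s a - r s a) ≤ u := fun s => by
    rw [← sum_sub_distrib]
    refine le_trans (sum_le_sum fun a _ => ?_) (hu s)
    have e : q s a * (p s a - r s a) - q s a * (p' s a - r s a) = q s a * (p s a - p' s a) := by
      ring
    rw [e]
    exact (mul_le_mul_of_nonneg_left (le_abs_self _) (hq s a).1).trans
      (mul_le_of_le_one_left (abs_nonneg _) (hq s a).2)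
  have hs : ∀ s, d s * ∑ a, q s a * (p s a - r s a) ≤
      d' s * ∑ a, q s a * (p' s a - r s a) + |d s - d' s| + d' s * u := fun s => by
    have h1 : (d s - d' s) * ∑ a, q s a * (p s a - r s a) ≤ |d s - d' s| := by
      refine (le_abs_self _).trans ?_
      rw [abs_mul]
      exact mul_le_of_le_one_right (abs_nonneg _) (hg s)
    have h2 := mul_le_mul_of_nonneg_left (hpu s) (hd s)
    linarith
  refine (sum_le_sum fun s _ => hs s).trans (le_of_eq ?_)
  rw [sum_add_distrib, sum_add_distrib, ← sum_mul, hd1, one_mul]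

/-- Splitting `{1, …, L * τ}` into `L` consecutive blocks of length `τ`. -/
theorem sum_Icc_mul_eq_sum_blocks (f : ℕ → ℝ) (L τ : ℕ) :
    ∑ k ∈ Finset.Icc 1 (L * τ), f k =
      ∑ l ∈ Finset.range L, ∑ i ∈ Finset.range τ, f (l * τ + 1 + i) := by
  have hIcc : ∀ n, ∑ k ∈ Finset.Icc 1 n, f k = ∑ k ∈ Finset.range n, f (k + 1) := fun n => by
    rw [Finset.range_eq_Ico, Finset.sum_Ico_add' f 0 n 1]
    rfl
  rw [hIcc]
  induction L with
  | zero => simp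
  | succ L ih =>
    rw [Nat.succ_mul, Finset.sum_range_add, ih, Finset.sum_range_succ]
    simp only [add_right_comm]

/-- Performance-difference term bound for mirror descent with periodic restarts. -/
theorem stmt_16 {S A : Type*} [Fintype S] [Fintype A] [Nonempty S] [Nonempty A] [DecidableEq S]
    (H K L τ : ℕ) (hH : 1 ≤ H) (hK : K = L * τ) (s₁ : S)
    (η : ℝ) (hη : η = Real.sqrt (L * Real.log (Fintype.card A) / K))
    (Pstar : ℕ → ℕ → S → A → S → ℝ)
    (hPstar : ∀ k ∈ Finset.Icc 1 K, ∀ h ∈ Finset.Icc 1 H, ∀ s a,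
      (∀ s', 0 ≤ Pstar k h s a s') ∧ ∑ s', Pstar k h s a s' = 1)
    -- comparator policies
    (πstar : ℕ → ℕ → S → A → ℝ)
    (hπstar : ∀ k ∈ Finset.Icc 1 K, ∀ h ∈ Finset.Icc 1 H, ∀ s,
      (∀ a, 0 ≤ πstar k h s a) ∧ ∑ a, πstar k h s a = 1)
    (Qhat : ℕ → ℕ → S → A → ℝ)
    (hQhat : ∀ k ∈ Finset.Icc 1 K, ∀ h ∈ Finset.Icc 1 H, ∀ s a,
      0 ≤ Qhat k h s a ∧ Qhat k h s a ≤ 1)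
    -- learner's policies: uniform restart every τ rounds, otherwise exponential-weights update
    (π : ℕ → ℕ → S → A → ℝ)
    (hrestart : ∀ k ∈ Finset.Icc 1 K, k % τ = 1 % τ → ∀ h ∈ Finset.Icc 1 H, ∀ s a,
      π k h s a = 1 / (Fintype.card A : ℝ))
    (hupdate : ∀ k ∈ Finset.Icc 1 K, ¬ k % τ = 1 % τ → ∀ h ∈ Finset.Icc 1 H, ∀ s a,
      π k h s a = π (k - 1) h s a * Real.exp (η * Qhat (k - 1) h s a) /
        ∑ a', π (k - 1) h s a' * Real.exp (η * Qhat (k - 1) h s a'))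
    -- `dd k h` : step-`h` state distribution under `(Pstar k, πstar k)` started from `s₁`
    (dd : ℕ → ℕ → S → ℝ)
    (hd1 : ∀ k ∈ Finset.Icc 1 K, ∀ s, dd k 1 s = if s = s₁ then 1 else 0)
    (hdstep : ∀ k ∈ Finset.Icc 1 K, ∀ h ∈ Finset.Icc 1 H, ∀ s',
      dd k (h + 1) s' = ∑ s, ∑ a, dd k h s * πstar k h s a * Pstar k h s a s') :
    ∑ k ∈ Finset.Icc 1 K, ∑ h ∈ Finset.Icc 1 H,
        ∑ s, dd k h s * ∑ a, Qhat k h s a * (πstar k h s a - π k h s a) ≤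
      2 * H * K * Real.sqrt (Real.log (Fintype.card A) / τ) +
      3 * H * τ *
        ((∑ k ∈ Finset.Icc 2 K, ∑ h ∈ Finset.Icc 1 H,
            Finset.univ.sup' Finset.univ_nonempty
              (fun sa : S × A =>
                (1 / 2) * ∑ s', |Pstar k h sa.1 sa.2 s' - Pstar (k - 1) h sa.1 sa.2 s'|)) +
         (∑ k ∈ Finset.Icc 2 K, ∑ h ∈ Finset.Icc 1 H,
            Finset.univ.sup' Finset.univ_nonempty
              (fun s : S => (1 / 2) * ∑ a, |πstar k h s a - πstar (k - 1) h s a|))) := by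
  set MP : ℕ → ℕ → ℝ := fun k h => Finset.univ.sup' Finset.univ_nonempty
    (fun sa : S × A =>
      (1 / 2) * ∑ s', |Pstar k h sa.1 sa.2 s' - Pstar (k - 1) h sa.1 sa.2 s'|) with hMP
  set Mπ : ℕ → ℕ → ℝ := fun k h => Finset.univ.sup' Finset.univ_nonempty
    (fun s : S => (1 / 2) * ∑ a, |πstar k h s a - πstar (k - 1) h s a|) with hMπ
  change _ ≤ _ + 3 * (H : ℝ) * τ * (∑ k ∈ Finset.Icc 2 K, ∑ h ∈ Finset.Icc 1 H, MP k h +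
    ∑ k ∈ Finset.Icc 2 K, ∑ h ∈ Finset.Icc 1 H, Mπ k h)
  have hMPle : ∀ k h s a, ∑ s', |Pstar k h s a s' - Pstar (k - 1) h s a s'| ≤ 2 * MP k h := by
    intro k h s a
    have := Finset.le_sup' (fun sa : S × A =>
      (1 / 2) * ∑ s', |Pstar k h sa.1 sa.2 s' - Pstar (k - 1) h sa.1 sa.2 s'|)
      (Finset.mem_univ (s, a))
    simp only [hMP]
    linarith
  have hMπle : ∀ k h s, ∑ a, |πstar k h s a - πstar (k - 1) h s a| ≤ 2 * Mπ k h := by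
    intro k h s
    have := Finset.le_sup' (fun s : S =>
      (1 / 2) * ∑ a, |πstar k h s a - πstar (k - 1) h s a|) (Finset.mem_univ s)
    simp only [hMπ]
    linarith
  clear_value MP Mπ
  have hM0 : ∀ k h, 0 ≤ MP k h + Mπ k h := fun k h => by
    have h1 := (Finset.sum_nonneg fun _ _ => abs_nonneg _).trans
      (hMPle k h s₁ (Classical.arbitrary A))
    have h2 := (Finset.sum_nonneg fun _ _ => abs_nonneg _).trans (hMπle k h s₁)
    linarith
  -- total variation at round `k`, discarding the meaningless comparison with round `0`
  set E : ℕ → ℝ := fun k => if 2 ≤ k then ∑ h ∈ Finset.Icc 1 H, (MP k h + Mπ k h) else 0 with hE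
  have hE0 : ∀ k, 0 ≤ E k := fun k => by
    simp only [hE]
    split_ifs
    exacts [Finset.sum_nonneg fun h _ => hM0 k h, le_rfl]
  have hEsum : ∑ k ∈ Finset.Icc 1 K, E k = ∑ k ∈ Finset.Icc 2 K, ∑ h ∈ Finset.Icc 1 H, MP k h +
      ∑ k ∈ Finset.Icc 2 K, ∑ h ∈ Finset.Icc 1 H, Mπ k h := by
    simp only [hE]
    rw [← Finset.sum_filter, ← Finset.sum_add_distrib]
    have hf : (Finset.Icc 1 K).filter (fun k => 2 ≤ k) = Finset.Icc 2 K := by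
      ext k; simp only [Finset.mem_filter, Finset.mem_Icc]; omega
    rw [hf]
    exact Finset.sum_congr rfl fun k _ => Finset.sum_add_distrib
  rw [← hEsum]
  rcases Nat.eq_zero_or_pos τ with hτ | hτ
  · subst hτ
    simp [hK]
  rcases Nat.eq_zero_or_pos L with hL | hL
  · subst hL
    simp [hK]
  have hη' : η = Real.sqrt (Real.log (Fintype.card A) / τ) := by
    rw [hη, hK]
    push_cast
    have hL' : (L : ℝ) ≠ 0 := by exact_mod_cast hL.ne'
    rw [mul_div_mul_left _ _ hL']
  have hmem : ∀ l < L, ∀ i < τ, l * τ + 1 + i ∈ Finset.Icc 1 K := fun l hl i hi => by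
    have : (l + 1) * τ ≤ L * τ := Nat.mul_le_mul_right τ hl
    rw [Nat.succ_mul] at this
    exact Finset.mem_Icc.2 ⟨by omega, by omega⟩
  have hstart : ∀ l < L, ∀ h ∈ Finset.Icc 1 H, ∀ s a,
      π (l * τ + 1 + 0) h s a = 1 / (Fintype.card A : ℝ) := fun l hl =>
    hrestart _ (hmem l hl 0 hτ) (by simp)
  have hnext : ∀ l < L, ∀ h ∈ Finset.Icc 1 H, ∀ s, ∀ i, i + 1 < τ → ∀ a,
      π (l * τ + 1 + (i + 1)) h s a =
        π (l * τ + 1 + i) h s a * Real.exp (η * Qhat (l * τ + 1 + i) h s a) /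
        ∑ a', π (l * τ + 1 + i) h s a' * Real.exp (η * Qhat (l * τ + 1 + i) h s a') := by
    intro l hl h hh s i hi a
    refine hupdate _ (hmem l hl (i + 1) hi) ?_ h hh s a
    rw [add_assoc, Nat.mul_add_mod', Nat.mod_eq_of_lt (show 1 < τ by omega)]
    rcases (show 1 + (i + 1) < τ ∨ 1 + (i + 1) = τ by omega) with h | h
    · rw [Nat.mod_eq_of_lt h]; omega
    · rw [h, Nat.mod_self]; omega
  have hround : ∀ l < L, ∀ i < τ, ∀ h ∈ Finset.Icc 1 H,
      ∑ s, dd (l * τ + 1 + i) h s * ∑ a, Qhat (l * τ + 1 + i) h s a *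
        (πstar (l * τ + 1 + i) h s a - π (l * τ + 1 + i) h s a) ≤
      ∑ s, dd (l * τ + 1) h s * ∑ a, Qhat (l * τ + 1 + i) h s a *
        (πstar (l * τ + 1) h s a - π (l * τ + 1 + i) h s a) +
      2 * ∑ j ∈ Finset.range τ, E (l * τ + 1 + j) := by
    intro l hl i hi h hh
    have hm0 := hmem l hl 0 hτ
    have hmi := hmem l hl i hi
    obtain ⟨h1, hle⟩ := Finset.mem_Icc.1 hh
    have hu : ∀ h ∈ Finset.Icc 1 H, ∀ s,
        ∑ a, |πstar (l * τ + 1 + i) h s a - πstar (l * τ + 1) h s a| ≤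
          ∑ j ∈ Finset.range i, 2 * Mπ (l * τ + 1 + j + 1) h := fun h _ s =>
      (sum_abs_sub_le_path (fun k => πstar k h s) _ i).trans
        (Finset.sum_le_sum fun j _ => hMπle (l * τ + 1 + j + 1) h s)
    have hv : ∀ h ∈ Finset.Icc 1 H, ∀ s a,
        ∑ s', |Pstar (l * τ + 1 + i) h s a s' - Pstar (l * τ + 1) h s a s'| ≤
          ∑ j ∈ Finset.range i, 2 * MP (l * τ + 1 + j + 1) h := fun h _ s a =>
      (sum_abs_sub_le_path (fun k => Pstar k h s a) _ i).trans
        (Finset.sum_le_sum fun j _ => hMPle (l * τ + 1 + j + 1) h s a)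
    obtain ⟨d0, d1⟩ := stateDist_simplex (hπstar _ hm0) (hPstar _ hm0) (hd1 _ hm0)
      (hdstep _ hm0) h1 hle
    have hr : ∀ s, (∀ a, 0 ≤ π (l * τ + 1 + i) h s a) ∧ ∑ a, π (l * τ + 1 + i) h s a = 1 :=
      fun s => by
        have := expWeights_simplex (p := fun i => π (l * τ + 1 + i) h s)
          (hstart l hl h hh s) (hnext l hl h hh s) i hi
        exact ⟨fun a => (this.1 a).le, this.2⟩
    have hadv := sum_mul_advantage_le (d := dd (l * τ + 1 + i) h) d0 d1 (hπstar _ hmi h hh) hr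
      (hQhat _ hmi h hh) (hu h hh)
    have hdist := sum_abs_stateDist_sub_le (hπstar _ hmi) (hπstar _ hm0) (hPstar _ hmi)
      (hPstar _ hm0) (hd1 _ hmi) (hd1 _ hm0) (hdstep _ hmi) (hdstep _ hm0) hu hv h1 hle
    have hw : ∀ h, ∑ j ∈ Finset.range i, 2 * Mπ (l * τ + 1 + j + 1) h +
        ∑ j ∈ Finset.range i, 2 * MP (l * τ + 1 + j + 1) h =
        2 * ∑ j ∈ Finset.range i, (MP (l * τ + 1 + j + 1) h + Mπ (l * τ + 1 + j + 1) h) :=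
      fun h => by
        rw [← Finset.sum_add_distrib, Finset.mul_sum]
        exact Finset.sum_congr rfl fun j _ => by ring
    have hMP0 : 0 ≤ ∑ j ∈ Finset.range i, 2 * MP (l * τ + 1 + j + 1) h :=
      (Finset.sum_nonneg fun _ _ => abs_nonneg _).trans (hv h hh s₁ (Classical.arbitrary A))
    have hsteps : ∑ h' ∈ Finset.Ico 1 (h + 1), 2 * ∑ j ∈ Finset.range i,
        (MP (l * τ + 1 + j + 1) h' + Mπ (l * τ + 1 + j + 1) h') ≤
        2 * ∑ j ∈ Finset.range τ, E (l * τ + 1 + j) := by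
      rw [← Finset.mul_sum, Finset.sum_comm]
      refine mul_le_mul_of_nonneg_left ?_ zero_le_two
      calc ∑ j ∈ Finset.range i, ∑ h' ∈ Finset.Ico 1 (h + 1),
            (MP (l * τ + 1 + j + 1) h' + Mπ (l * τ + 1 + j + 1) h')
          ≤ ∑ j ∈ Finset.range i, E (l * τ + 1 + (j + 1)) := by
            refine Finset.sum_le_sum fun j _ => ?_
            simp only [hE]
            rw [if_pos (by omega)]
            refine Finset.sum_le_sum_of_subset_of_nonneg (fun x hx => ?_) fun h' _ _ => hM0 _ h'
            simp only [Finset.mem_Ico, Finset.mem_Icc] at hx ⊢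
            omega
        _ ≤ ∑ j ∈ Finset.range (i + 1), E (l * τ + 1 + j) := by
            rw [Finset.sum_range_succ' (fun j => E (l * τ + 1 + j))]
            exact le_add_of_nonneg_right (hE0 _)
        _ ≤ ∑ j ∈ Finset.range τ, E (l * τ + 1 + j) :=
            Finset.sum_le_sum_of_subset_of_nonneg (Finset.range_subset_range.2 hi)
              fun j _ _ => hE0 _
    rw [Finset.sum_Ico_succ_top h1, ← hw h] at hsteps
    simp only [hw] at hdist
    linarith
  have hblock : ∀ l < L, ∑ i ∈ Finset.range τ, ∑ h ∈ Finset.Icc 1 H,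
      ∑ s, dd (l * τ + 1 + i) h s * ∑ a, Qhat (l * τ + 1 + i) h s a *
        (πstar (l * τ + 1 + i) h s a - π (l * τ + 1 + i) h s a) ≤
      H * (2 * τ * η) + 2 * H * τ * ∑ j ∈ Finset.range τ, E (l * τ + 1 + j) := by
    intro l hl
    have hm0 := hmem l hl 0 hτ
    refine (Finset.sum_le_sum fun i hi => Finset.sum_le_sum fun h hh =>
      hround l hl i (Finset.mem_range.1 hi) h hh).trans ?_
    simp only [Finset.sum_add_distrib, Finset.sum_const, Finset.card_range, Nat.card_Icc,
      nsmul_eq_mul, Nat.add_sub_cancel]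
    have hreg : ∀ h ∈ Finset.Icc 1 H, ∑ i ∈ Finset.range τ,
        ∑ s, dd (l * τ + 1) h s * ∑ a, Qhat (l * τ + 1 + i) h s a *
          (πstar (l * τ + 1) h s a - π (l * τ + 1 + i) h s a) ≤ 2 * τ * η := by
      intro h hh
      obtain ⟨h1, hle⟩ := Finset.mem_Icc.1 hh
      obtain ⟨d0, d1⟩ := stateDist_simplex (hπstar _ hm0) (hPstar _ hm0) (hd1 _ hm0)
        (hdstep _ hm0) h1 hle
      rw [Finset.sum_comm]
      calc _ ≤ ∑ s, dd (l * τ + 1) h s * (2 * τ * η) := by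
            refine Finset.sum_le_sum fun s _ => ?_
            rw [← Finset.mul_sum]
            exact mul_le_mul_of_nonneg_left
              (expWeights_regret (p := fun i => π (l * τ + 1 + i) h s)
                (q := fun i => Qhat (l * τ + 1 + i) h s) hτ hη'
                (fun i hi => hQhat _ (hmem l hl i hi) h hh s)
                (hstart l hl h hh s) (hnext l hl h hh s)
                (hπstar _ hm0 h hh s).1 (hπstar _ hm0 h hh s).2) (d0 s)
        _ = 2 * τ * η := by rw [← Finset.sum_mul, d1, one_mul]
    have hregsum := Finset.sum_le_sum hreg
    rw [Finset.sum_comm] at hregsum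
    simp only [Finset.sum_const, Nat.card_Icc, nsmul_eq_mul, Nat.add_sub_cancel] at hregsum
    linarith
  have hEpos : 0 ≤ ∑ k ∈ Finset.Icc 1 K, E k := Finset.sum_nonneg fun k _ => hE0 k
  have hfinal : ∑ k ∈ Finset.Icc 1 K, ∑ h ∈ Finset.Icc 1 H,
      ∑ s, dd k h s * ∑ a, Qhat k h s a * (πstar k h s a - π k h s a) ≤
      2 * H * K * η + 2 * H * τ * ∑ k ∈ Finset.Icc 1 K, E k := by
    rw [hK, sum_Icc_mul_eq_sum_blocks, sum_Icc_mul_eq_sum_blocks]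
    refine (Finset.sum_le_sum fun l hl => hblock l (Finset.mem_range.1 hl)).trans (le_of_eq ?_)
    rw [Finset.sum_add_distrib, Finset.sum_const, Finset.card_range, nsmul_eq_mul,
      ← Finset.mul_sum]
    push_cast
    ring
  rw [← hη']
  refine hfinal.trans ?_
  have : 0 ≤ (H : ℝ) * τ * ∑ k ∈ Finset.Icc 1 K, E k := by positivity
  linarith
end
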